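/- arXiv:2207.08791 — 2 statements merged into one kernel-verified Lean document; each statement's English description precedes it below -/
import Mathlib

section
/- Let p and q be probability distributions on ℕ×ℕ whose first marginals p₁ and q₁ have finite supports of sizes m_p ≥ 1 and m_q ≥ 1 respectively. Then for every ε ∈ (0,1] with TV(p,q) ≤ ε one has −( ε·ln m_q + g(ε) ) ≤ H(X₁|X₂)_p − H(X₁|X₂)_q ≤ ε·ln m_p + g(ε). -/
open scoped ENNReal

/-- `p` is a probability distribution on `α`: nonnegative entries summing to `1`. -/
def IsProbDist {α : Type*} (p : α → ℝ) : Prop := (∀ x, 0 ≤ p x) ∧ HasSum p 1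

/-- Extended-real-valued Shannon entropy `H(r) = ∑ η(r i) ∈ [0,+∞]`,
where `η(x) = −x ln x`. -/
noncomputable def shEnt (r : ℕ → ℝ) : ℝ≥0∞ :=
  ∑' i, ENNReal.ofReal (Real.negMulLog (r i))

/-- Total variation distance `TV(p,q) = (1/2)·∑ |p x − q x|`. -/
noncomputable def TVd {α : Type*} (p q : α → ℝ) : ℝ := (1 / 2) * ∑' x, |p x - q x|

/-- `g(x) = (x+1)·ln(x+1) − x·ln x` (with `g(0) = 0`, as `Real.log 0 = 0`). -/
noncomputable def gFun (x : ℝ) : ℝ := (x + 1) * Real.log (x + 1) - x * Real.log x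

/-- First marginal `p₁(i) = ∑_j p(i,j)`. -/
noncomputable def marg1 (p : ℕ × ℕ → ℝ) (i : ℕ) : ℝ := ∑' j, p (i, j)

/-- Second marginal `p₂(j) = ∑_i p(i,j)`. -/
noncomputable def marg2 (p : ℕ × ℕ → ℝ) (j : ℕ) : ℝ := ∑' i, p (i, j)

/-- Conditional Shannon entropy
`H(X₁|X₂)_p = ∑_{j : p₂(j) > 0} p₂(j)·H(p(·|j)) ∈ [0,+∞]`
(terms with `p₂(j) = 0` contribute `0`, since `0·∞ = 0` in `ℝ≥0∞` and division
by zero gives the zero distribution). -/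
noncomputable def condEnt (p : ℕ × ℕ → ℝ) : ℝ≥0∞ :=
  ∑' j, ENNReal.ofReal (marg2 p j) * shEnt fun i => p (i, j) / marg2 p j

/-- The perspective `(x, y) ↦ x ln (y / x)` of the logarithm lies below its tangent planes. -/
lemma mul_log_div_le_tangent {x y r : ℝ} (hx : 0 ≤ x) (hxy : x ≤ y) (hr : 0 < r) :
    x * Real.log (y / x) ≤ x * Real.log r + y / r - x := by
  rcases hx.eq_or_lt with rfl | hx
  · simpa using div_nonneg hxy hr.le
  have hy : 0 < y := hx.trans_le hxy
  have h := Real.log_le_sub_one_of_pos (show 0 < y / x / r by positivity)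
  rw [Real.log_div (by positivity) hr.ne'] at h
  have h' := mul_le_mul_of_nonneg_left h hx.le
  have e : x * (y / x / r - 1) = y / r - x := by field_simp
  rw [e] at h'
  linarith

lemma mul_log_div_nonneg {x y : ℝ} (hx : 0 ≤ x) (hxy : x ≤ y) : 0 ≤ x * Real.log (y / x) := by
  rcases hx.eq_or_lt with rfl | hx
  · simp
  · exact mul_nonneg hx.le (Real.log_nonneg ((one_le_div hx).2 hxy))

/-- The perspective `(x, y) ↦ x ln (y / x)` of the logarithm is superadditive. -/
lemma mul_log_div_add_le {x y u v : ℝ} (hx : 0 ≤ x) (hxy : x ≤ y) (hu : 0 ≤ u) (huv : u ≤ v) :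
    x * Real.log (y / x) + u * Real.log (v / u) ≤
      (x + u) * Real.log ((y + v) / (x + u)) := by
  rcases (add_nonneg hx hu).eq_or_lt with h | h
  · have hx0 : x = 0 := by linarith
    have hu0 : u = 0 := by linarith
    simp [hx0, hu0]
  have hyv : 0 < y + v := by linarith
  have hr : 0 < (y + v) / (x + u) := by positivity
  have h1 := mul_log_div_le_tangent hx hxy hr
  have h2 := mul_log_div_le_tangent hu huv hr
  have e : y / ((y + v) / (x + u)) + v / ((y + v) / (x + u)) = x + u := by
    field_simp
  linarith

/-- Entropy of the nonnegative vector `x` on `T`, scaled by its total mass: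
the homogeneous extension of the Shannon entropy. -/
noncomputable def homEnt (T : Finset ℕ) (x : ℕ → ℝ) : ℝ :=
  ∑ i ∈ T, x i * Real.log ((∑ k ∈ T, x k) / x i)

lemma homEnt_nonneg (T : Finset ℕ) {x : ℕ → ℝ} (hx : ∀ i, 0 ≤ x i) : 0 ≤ homEnt T x :=
  Finset.sum_nonneg fun i hi =>
    mul_log_div_nonneg (hx i) (Finset.single_le_sum (fun k _ => hx k) hi)

lemma homEnt_eq_of_subset {S T : Finset ℕ} (hST : S ⊆ T) {x : ℕ → ℝ}
    (h0 : ∀ i ∉ S, x i = 0) : homEnt T x = homEnt S x := by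
  unfold homEnt
  rw [← Finset.sum_subset hST fun i _ hi => h0 i hi]
  exact (Finset.sum_subset hST fun i _ hi => by simp [h0 i hi]).symm

lemma homEnt_le_log_card {S : Finset ℕ} (hS : S.Nonempty) {x : ℕ → ℝ} (hx : ∀ i, 0 ≤ x i) :
    homEnt S x ≤ (∑ i ∈ S, x i) * Real.log S.card := by
  have hc : (0 : ℝ) < S.card := by exact_mod_cast hS.card_pos
  calc homEnt S x
      ≤ ∑ i ∈ S, (x i * Real.log S.card + (∑ k ∈ S, x k) / S.card - x i) :=
        Finset.sum_le_sum fun i hi =>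
          mul_log_div_le_tangent (hx i) (Finset.single_le_sum (fun k _ => hx k) hi) hc
    _ = (∑ i ∈ S, x i) * Real.log S.card := by
        rw [Finset.sum_sub_distrib, Finset.sum_add_distrib, ← Finset.sum_mul, Finset.sum_const,
          nsmul_eq_mul, mul_div_cancel₀ _ hc.ne']
        ring

lemma homEnt_add_le (T : Finset ℕ) {x u : ℕ → ℝ} (hx : ∀ i, 0 ≤ x i) (hu : ∀ i, 0 ≤ u i) :
    homEnt T x + homEnt T u ≤ homEnt T (x + u) := by
  unfold homEnt
  rw [← Finset.sum_add_distrib]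
  refine Finset.sum_le_sum fun i hi => ?_
  simp only [Pi.add_apply, Finset.sum_add_distrib]
  exact mul_log_div_add_le (hx i) (Finset.single_le_sum (fun k _ => hx k) hi) (hu i)
    (Finset.single_le_sum (fun k _ => hu k) hi)

lemma mul_log_div_le_of_le {y w s t : ℝ} (hy : 0 ≤ y) (hyw : y ≤ w) (hys : y ≤ s)
    (hst : s ≤ t) :
    y * Real.log (t / w) ≤ y * Real.log (s / y) + y * Real.log (t / s) := by
  rcases hy.eq_or_lt with rfl | hy
  · simp
  have hs : 0 < s := hy.trans_le hys
  have ht : 0 < t := hs.trans_le hst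
  have hw : 0 < w := hy.trans_le hyw
  rw [← mul_add, Real.log_div ht.ne' hw.ne', Real.log_div hs.ne' hy.ne',
    Real.log_div ht.ne' hs.ne']
  have := Real.log_le_log hy hyw
  exact mul_le_mul_of_nonneg_left (by linarith) hy.le

/-- Almost-convexity of the entropy: mixing adds at most the entropy of the mixing weights, here
bounded through the tangent plane with slope parameter `ε`. -/
lemma homEnt_add_le_add (T : Finset ℕ) {y a : ℕ → ℝ} (hy : ∀ i, 0 ≤ y i) (ha : ∀ i, 0 ≤ a i)
    {ε : ℝ} (hε : 0 < ε) :
    homEnt T (y + a) ≤ homEnt T y + homEnt T a + (∑ i ∈ T, y i) * Real.log (1 + ε) +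
      (∑ i ∈ T, a i) * Real.log ((1 + ε) / ε) := by
  set s := ∑ i ∈ T, y i with hs
  set t := ∑ i ∈ T, a i with ht
  have hs0 : 0 ≤ s := Finset.sum_nonneg fun i _ => hy i
  have ht0 : 0 ≤ t := Finset.sum_nonneg fun i _ => ha i
  have hsplit : homEnt T (y + a) ≤ homEnt T y + homEnt T a +
      (s * Real.log ((s + t) / s) + t * Real.log ((s + t) / t)) := by
    unfold homEnt
    rw [← hs, ← ht]
    nth_rewrite 2 [hs]
    nth_rewrite 4 [ht]
    rw [Finset.sum_mul, Finset.sum_mul, ← Finset.sum_add_distrib, ← Finset.sum_add_distrib,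
      ← Finset.sum_add_distrib]
    refine Finset.sum_le_sum fun i hi => ?_
    simp only [Pi.add_apply, Finset.sum_add_distrib, ← hs, ← ht]
    have h1 := mul_log_div_le_of_le (hy i) (le_add_of_nonneg_right (ha i))
      (Finset.single_le_sum (fun k _ => hy k) hi) (le_add_of_nonneg_right ht0 : s ≤ s + t)
    have h2 := mul_log_div_le_of_le (ha i) (le_add_of_nonneg_left (hy i))
      (Finset.single_le_sum (fun k _ => ha k) hi) (le_add_of_nonneg_left hs0 : t ≤ s + t)
    rw [add_mul]
    linarith
  have h1 := mul_log_div_le_tangent hs0 (le_add_of_nonneg_right ht0 : s ≤ s + t)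
    (show 0 < 1 + ε by linarith)
  have h2 := mul_log_div_le_tangent ht0 (le_add_of_nonneg_left hs0 : t ≤ s + t)
    (show 0 < (1 + ε) / ε by positivity)
  have e : (s + t) / (1 + ε) + (s + t) / ((1 + ε) / ε) = s + t := by
    field_simp
  linarith

lemma homEnt_le_of_excess {S T : Finset ℕ} (hST : S ⊆ T) (hS : S.Nonempty) {x y : ℕ → ℝ}
    (hx : ∀ i, 0 ≤ x i) (hy : ∀ i, 0 ≤ y i) (h0 : ∀ i ∉ S, x i = 0) {ε : ℝ} (hε : 0 < ε) :
    homEnt T x ≤ homEnt T y + ((∑ i ∈ T, y i) * Real.log (1 + ε) +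
      (∑ i ∈ T, max (x i - y i) 0) * (Real.log S.card + Real.log ((1 + ε) / ε))) := by
  set a : ℕ → ℝ := fun i => max (x i - y i) 0 with ha_def
  set b : ℕ → ℝ := fun i => max (y i - x i) 0 with hb_def
  have ha : ∀ i, 0 ≤ a i := fun i => le_max_right _ _
  have hb : ∀ i, 0 ≤ b i := fun i => le_max_right _ _
  have ha0 : ∀ i ∉ S, a i = 0 := fun i hi => by simp [ha_def, h0 i hi, hy i]
  have hxb : x + b = y + a := by
    ext i
    simp only [ha_def, hb_def, Pi.add_apply]
    rcases le_total (x i) (y i) with h | h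
    · rw [max_eq_left (sub_nonneg.2 h), max_eq_right (sub_nonpos.2 h)]; ring
    · rw [max_eq_right (sub_nonpos.2 h), max_eq_left (sub_nonneg.2 h)]; ring
  have h1 := homEnt_add_le T hx hb
  have h2 := homEnt_add_le_add T hy ha hε
  have h3 := homEnt_le_log_card hS ha
  rw [← homEnt_eq_of_subset hST ha0, Finset.sum_subset hST fun i _ hi => ha0 i hi] at h3
  have h4 := homEnt_nonneg T hb
  rw [hxb] at h1
  rw [mul_add]
  linarith

lemma marg2_eq_sum {T : Finset ℕ} {f : ℕ × ℕ → ℝ} (h0 : ∀ i ∉ T, ∀ j, f (i, j) = 0) (j : ℕ) :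
    marg2 f j = ∑ i ∈ T, f (i, j) :=
  tsum_eq_sum fun i hi => h0 i hi j

lemma hasSum_column {T : Finset ℕ} {f : ℕ × ℕ → ℝ} (h0 : ∀ i ∉ T, ∀ j, f (i, j) = 0) {s : ℝ}
    (hf : HasSum f s) : HasSum (fun j => ∑ i ∈ T, f (i, j)) s := by
  have h := (Equiv.prodComm ℕ ℕ).hasSum_iff.2 hf
  exact h.prod_fiberwise fun j => hasSum_sum_of_ne_finset_zero fun i hi => h0 i hi j

lemma condEnt_eq_tsum_homEnt {T : Finset ℕ} {f : ℕ × ℕ → ℝ} (hf : ∀ x, 0 ≤ f x)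
    (h0 : ∀ i ∉ T, ∀ j, f (i, j) = 0) :
    condEnt f = ∑' j, ENNReal.ofReal (homEnt T fun i => f (i, j)) := by
  unfold condEnt
  congr 1
  ext j
  rw [marg2_eq_sum h0 j]
  set s := ∑ i ∈ T, f (i, j) with hs
  have hs0 : 0 ≤ s := Finset.sum_nonneg fun i _ => hf _
  have hle : ∀ i ∈ T, f (i, j) ≤ s := fun i hi =>
    Finset.single_le_sum (f := fun k => f (k, j)) (fun k _ => hf _) hi
  unfold shEnt homEnt
  rw [tsum_eq_sum (s := T) (fun i hi => by simp [h0 i hi j]), Finset.mul_sum,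
    ENNReal.ofReal_sum_of_nonneg fun i hi => mul_log_div_nonneg (hf _) (hle i hi)]
  refine Finset.sum_congr rfl fun i hi => ?_
  rw [← ENNReal.ofReal_mul hs0]
  congr 1
  rcases hs0.eq_or_lt with h | h
  · have : f (i, j) = 0 := le_antisymm (h ▸ hle i hi) (hf _)
    simp [this]
  · rw [← inv_div (f (i, j)) s, Real.log_inv, Real.negMulLog]
    field_simp

lemma eq_zero_of_marg1_eq_zero {p : ℕ × ℕ → ℝ} (hp : IsProbDist p) {i : ℕ}
    (hi : marg1 p i = 0) (j : ℕ) : p (i, j) = 0 := by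
  have hs : Summable fun j => p (i, j) := hp.2.summable.prod_factor i
  have hsum : HasSum (fun j => p (i, j)) (marg1 p i) := hs.hasSum
  rw [hi, hasSum_zero_iff_of_nonneg fun j => hp.1 (i, j)] at hsum
  exact congrFun hsum j

lemma condEnt_ne_top {S : Finset ℕ} (hS : S.Nonempty) {p : ℕ × ℕ → ℝ} (hp : IsProbDist p)
    (h0 : ∀ i ∉ S, ∀ j, p (i, j) = 0) : condEnt p ≠ ⊤ := by
  rw [condEnt_eq_tsum_homEnt hp.1 h0]
  refine ne_top_of_le_ne_top ?_ (ENNReal.tsum_le_tsum fun j =>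
    ENNReal.ofReal_le_ofReal (homEnt_le_log_card hS fun i => hp.1 (i, j)))
  exact ((hasSum_column h0 hp.2).mul_right _).summable.tsum_ofReal_ne_top

lemma hasSum_max_sub {α : Type*} {p q : α → ℝ} (hp : IsProbDist p) (hq : IsProbDist q) :
    HasSum (fun x => max (p x - q x) 0) (TVd p q) := by
  have h := hp.2.sub hq.2
  have h' := (h.summable.abs.hasSum.add h).mul_left (1 / 2)
  rw [sub_self, add_zero] at h'
  have e : (fun x => max (p x - q x) 0) = fun x => 1 / 2 * (|p x - q x| + (p x - q x)) := by
    funext x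
    rw [max_def]
    split_ifs with h
    · rw [abs_of_nonpos h]; ring
    · rw [abs_of_pos (not_le.1 h)]; ring
  rw [e]
  exact h'

lemma condEnt_le_add {p q : ℕ × ℕ → ℝ} (hp : IsProbDist p) (hq : IsProbDist q)
    {S R : Finset ℕ} (hS : S.Nonempty) (hpS : ∀ i ∉ S, ∀ j, p (i, j) = 0)
    (hqR : ∀ i ∉ R, ∀ j, q (i, j) = 0) {ε : ℝ} (hε : 0 < ε) (hTV : TVd p q ≤ ε) :
    condEnt p ≤ condEnt q + ENNReal.ofReal (ε * Real.log S.card + gFun ε) := by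
  have hpT : ∀ i ∉ S ∪ R, ∀ j, p (i, j) = 0 := fun i hi =>
    hpS i fun h => hi (Finset.mem_union_left _ h)
  have hqT : ∀ i ∉ S ∪ R, ∀ j, q (i, j) = 0 := fun i hi =>
    hqR i fun h => hi (Finset.mem_union_right _ h)
  have hlog1 : 0 ≤ Real.log (1 + ε) := Real.log_nonneg (by linarith)
  have hlog2 : 0 ≤ Real.log ((1 + ε) / ε) :=
    Real.log_nonneg ((one_le_div hε).2 (by linarith))
  have hcard : 0 ≤ Real.log S.card := Real.log_natCast_nonneg _
  have hsum := ((hasSum_column hqT hq.2).mul_right (Real.log (1 + ε))).add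
    ((hasSum_column (T := S ∪ R) (fun i hi j => by simp [hpT i hi j, hqT i hi j])
      (hasSum_max_sub hp hq)).mul_right (Real.log S.card + Real.log ((1 + ε) / ε)))
  have hnonneg : ∀ j, 0 ≤ (∑ i ∈ S ∪ R, q (i, j)) * Real.log (1 + ε) +
      (∑ i ∈ S ∪ R, max (p (i, j) - q (i, j)) 0) *
        (Real.log S.card + Real.log ((1 + ε) / ε)) := fun j =>
    add_nonneg (mul_nonneg (Finset.sum_nonneg fun i _ => hq.1 _) hlog1)
      (mul_nonneg (Finset.sum_nonneg fun i _ => le_max_right _ _) (add_nonneg hcard hlog2))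
  rw [condEnt_eq_tsum_homEnt hp.1 hpT, condEnt_eq_tsum_homEnt hq.1 hqT]
  calc ∑' j, ENNReal.ofReal (homEnt (S ∪ R) fun i => p (i, j))
      ≤ ∑' j, (ENNReal.ofReal (homEnt (S ∪ R) fun i => q (i, j)) + ENNReal.ofReal
          ((∑ i ∈ S ∪ R, q (i, j)) * Real.log (1 + ε) +
            (∑ i ∈ S ∪ R, max (p (i, j) - q (i, j)) 0) *
              (Real.log S.card + Real.log ((1 + ε) / ε)))) := by
        refine ENNReal.tsum_le_tsum fun j => ?_
        rw [← ENNReal.ofReal_add (homEnt_nonneg _ fun i => hq.1 _) (hnonneg j)]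
        exact ENNReal.ofReal_le_ofReal (homEnt_le_of_excess Finset.subset_union_left hS
          (fun i => hp.1 _) (fun i => hq.1 _) (fun i hi => hpS i hi j) hε)
    _ ≤ _ := by
        rw [ENNReal.tsum_add, ← ENNReal.ofReal_tsum_of_nonneg hnonneg hsum.summable,
          hsum.tsum_eq]
        refine add_le_add le_rfl (ENNReal.ofReal_le_ofReal ?_)
        have h := mul_le_mul_of_nonneg_right hTV (add_nonneg hcard hlog2)
        have e : Real.log ((1 + ε) / ε) = Real.log (1 + ε) - Real.log ε :=
          Real.log_div (by positivity) hε.ne'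
        rw [gFun, add_comm ε 1]
        rw [e] at h ⊢
        linarith

lemma TVd_comm {α : Type*} (p q : α → ℝ) : TVd p q = TVd q p := by
  simp only [TVd, abs_sub_comm]

lemma gFun_nonneg {ε : ℝ} (hε : 0 < ε) : 0 ≤ gFun ε := by
  have h1 : 0 ≤ Real.log (ε + 1) := Real.log_nonneg (by linarith)
  have h2 : Real.log ε ≤ Real.log (ε + 1) := Real.log_le_log hε (by linarith)
  have h3 := mul_le_mul_of_nonneg_left h2 hε.le
  rw [gFun]
  linarith

/-- **Two-sided continuity bound for the conditional Shannon entropy under rank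
constraints on the first marginals**: if `p₁` and `q₁` have finite supports of
sizes `m_p ≥ 1` and `m_q ≥ 1`, then for `TV(p,q) ≤ ε ≤ 1`,
`−(ε·ln m_q + g(ε)) ≤ H(X₁|X₂)_p − H(X₁|X₂)_q ≤ ε·ln m_p + g(ε)`. -/
theorem condEntropy_rank_two_side_bound
    (p : ℕ × ℕ → ℝ) (hp : IsProbDist p)
    (q : ℕ × ℕ → ℝ) (hq : IsProbDist q)
    (hfinp : (Function.support (marg1 p)).Finite)
    (hfinq : (Function.support (marg1 q)).Finite)
    (mp mq : ℕ) (hmp : mp = (Function.support (marg1 p)).ncard)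
    (hmq : mq = (Function.support (marg1 q)).ncard)
    (hmp1 : 1 ≤ mp) (hmq1 : 1 ≤ mq)
    (ε : ℝ) (hε0 : 0 < ε) (hε1 : ε ≤ 1) (hTV : TVd p q ≤ ε) :
    ((-(ε * Real.log mq + gFun ε) : ℝ) : EReal) ≤
        (condEnt p : EReal) - (condEnt q : EReal) ∧
    (condEnt p : EReal) - (condEnt q : EReal) ≤
        ((ε * Real.log mp + gFun ε : ℝ) : EReal) := by
  have hS : hfinp.toFinset.Nonempty := by
    rw [← Finset.card_pos, ← Set.ncard_eq_toFinset_card _ hfinp]; omega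
  have hR : hfinq.toFinset.Nonempty := by
    rw [← Finset.card_pos, ← Set.ncard_eq_toFinset_card _ hfinq]; omega
  have hpS : ∀ i ∉ hfinp.toFinset, ∀ j, p (i, j) = 0 := fun i hi =>
    eq_zero_of_marg1_eq_zero hp (by simpa using hi)
  have hqR : ∀ i ∉ hfinq.toFinset, ∀ j, q (i, j) = 0 := fun i hi =>
    eq_zero_of_marg1_eq_zero hq (by simpa using hi)
  have h1 := condEnt_le_add hp hq hS hpS hqR hε0 hTV
  have h2 := condEnt_le_add hq hp hR hqR hpS hε0 (TVd_comm p q ▸ hTV)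
  rw [← Set.ncard_eq_toFinset_card _ hfinp, ← hmp] at h1
  rw [← Set.ncard_eq_toFinset_card _ hfinq, ← hmq] at h2
  have hBp : 0 ≤ ε * Real.log mp + gFun ε :=
    add_nonneg (mul_nonneg hε0.le (Real.log_natCast_nonneg _)) (gFun_nonneg hε0)
  have hBq : 0 ≤ ε * Real.log mq + gFun ε :=
    add_nonneg (mul_nonneg hε0.le (Real.log_natCast_nonneg _)) (gFun_nonneg hε0)
  rw [← ENNReal.ofReal_toReal (condEnt_ne_top hS hp hpS),
    ← ENNReal.ofReal_toReal (condEnt_ne_top hR hq hqR)] at h1 h2 ⊢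
  have hP : 0 ≤ (condEnt p).toReal := ENNReal.toReal_nonneg
  have hQ : 0 ≤ (condEnt q).toReal := ENNReal.toReal_nonneg
  rw [← ENNReal.ofReal_add hQ hBp, ENNReal.ofReal_le_ofReal_iff (add_nonneg hQ hBp)] at h1
  rw [← ENNReal.ofReal_add hP hBq, ENNReal.ofReal_le_ofReal_iff (add_nonneg hP hBq)] at h2
  rw [EReal.coe_ennreal_ofReal, EReal.coe_ennreal_ofReal, max_eq_left hP, max_eq_left hQ,
    ← EReal.coe_sub, EReal.coe_le_coe_iff, EReal.coe_le_coe_iff]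
  constructor <;> linarith
end

section
/- Let p be a probability distribution on ℕ×ℕ with ∑_{i,j} i·p(i,j) ≤ t for some t > 0. Then for every probability distribution q on ℕ×ℕ and every ε ∈ (0,1] with TV(p,q) ≤ ε one has H(X₁|X₂)_p − H(X₁|X₂)_q ≤ ε·g(t/ε) + g(ε), where H(X₁|X₂)_q is taken in [0,+∞] and the inequality is read in the extended reals (H(X₁|X₂)_p ≤ g(t) is finite). No constraint is imposed on q other than TV(p,q) ≤ ε. -/
open scoped ENNReal

open Real in
/-- The perspective of `negMulLog` lies below its tangent hyperplanes. -/
lemma mul_negMulLog_div_le {x F r : ℝ} (hx : 0 ≤ x) (hxF : x ≤ F) (hr : 0 < r) :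
    F * negMulLog (x / F) ≤ -(x * log r) + F * r - x := by
  rcases hx.eq_or_lt with rfl | hx
  · simp only [zero_div, negMulLog_zero]
    nlinarith
  have hF : 0 < F := hx.trans_le hxF
  have h1 : F * negMulLog (x / F) = -(x * log r) + x * log (F * r / x) := by
    rw [negMulLog, log_div hx.ne' hF.ne', log_div (by positivity) hx.ne', log_mul hF.ne' hr.ne']
    field_simp
    ring
  have h2 := mul_le_mul_of_nonneg_left (log_le_sub_one_of_pos (show 0 < F * r / x by positivity))
    hx.le
  have h3 : x * (F * r / x - 1) = F * r - x := by field_simp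
  linarith

open Real in
lemma mul_negMulLog_div_nonneg {x F : ℝ} (hx : 0 ≤ x) (hxF : x ≤ F) :
    0 ≤ F * negMulLog (x / F) :=
  mul_nonneg (hx.trans hxF)
    (negMulLog_nonneg (div_nonneg hx (hx.trans hxF)) (div_le_one_of_le₀ hxF (hx.trans hxF)))

open Real in
/-- The perspective of `negMulLog` is superadditive. -/
lemma mul_negMulLog_div_add_le {x y F G : ℝ} (hx : 0 ≤ x) (hxF : x ≤ F) (hy : 0 ≤ y)
    (hyG : y ≤ G) :
    F * negMulLog (x / F) + G * negMulLog (y / G) ≤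
      (F + G) * negMulLog ((x + y) / (F + G)) := by
  rcases (add_nonneg hx hy).eq_or_lt with h0 | h0
  · have hx0 : x = 0 := by linarith
    have hy0 : y = 0 := by linarith
    simp [hx0, hy0]
  have hFG : 0 < F + G := by linarith
  have hr : 0 < (x + y) / (F + G) := by positivity
  have h1 := mul_negMulLog_div_le hx hxF hr
  have h2 := mul_negMulLog_div_le hy hyG hr
  have h3 : (F + G) * negMulLog ((x + y) / (F + G)) =
      -((x + y) * log ((x + y) / (F + G))) := by
    rw [negMulLog]
    field_simp
  have h4 : (F + G) * ((x + y) / (F + G)) = x + y := by field_simp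
  nlinarith

open Real in
lemma neg_mul_log_div_le_mul_negMulLog_div {x z F S : ℝ} (hx : 0 ≤ x) (hxF : x ≤ F)
    (hxz : x ≤ z) (hS : F ≤ S) :
    -(x * log (z / S)) ≤ F * negMulLog (x / F) + x * log (S / F) := by
  rcases hx.eq_or_lt with rfl | hx
  · simp
  have hF : 0 < F := hx.trans_le hxF
  have hS' : 0 < S := hF.trans_le hS
  have h1 : F * negMulLog (x / F) = -(x * log (x / F)) := by
    rw [negMulLog]
    field_simp
  rw [h1, log_div (hx.trans_le hxz).ne' hS'.ne', log_div hx.ne' hF.ne', log_div hS'.ne' hF.ne']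
  have := mul_le_mul_of_nonneg_left (log_le_log hx hxz) hx.le
  nlinarith

open Real in
/-- The perspective of `negMulLog` is subadditive up to a mixing term. -/
lemma mul_negMulLog_add_div_le {x y F G : ℝ} (hx : 0 ≤ x) (hxF : x ≤ F) (hy : 0 ≤ y)
    (hyG : y ≤ G) :
    (F + G) * negMulLog ((x + y) / (F + G)) ≤
      F * negMulLog (x / F) + G * negMulLog (y / G)
        + (x * log ((F + G) / F) + y * log ((F + G) / G)) := by
  have h1 := neg_mul_log_div_le_mul_negMulLog_div hx hxF (show x ≤ x + y by linarith)
    (show F ≤ F + G by linarith)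
  have h2 := neg_mul_log_div_le_mul_negMulLog_div hy hyG (show y ≤ x + y by linarith)
    (show G ≤ F + G by linarith)
  have h3 : (F + G) * negMulLog ((x + y) / (F + G)) =
      -((x + y) * log ((x + y) / (F + G))) := by
    rcases (show 0 ≤ F + G by linarith).eq_or_lt with h | h
    · simp [← h]
    · rw [negMulLog]
      field_simp
  linarith

open Real in
lemma mul_log_add_div_add_le {F G e : ℝ} (hF : 0 ≤ F) (hG : 0 ≤ G) (he : 0 < e) :
    F * log ((F + G) / F) + G * log ((F + G) / G) ≤
      (F + G) * log (1 + e) + G * -log e := by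
  have key : ∀ {x S : ℝ}, 0 ≤ x → x ≤ S →
      x * log (S / x) = S * negMulLog (x / S) := by
    intro x S hx hxS
    rcases hx.eq_or_lt with rfl | hx
    · simp
    have hS := hx.trans_le hxS
    rw [negMulLog, log_div hS.ne' hx.ne', log_div hx.ne' hS.ne']
    field_simp
    ring
  have h1 := mul_negMulLog_div_le hF (show F ≤ F + G by linarith)
    (show 0 < 1 / (1 + e) by positivity)
  have h2 := mul_negMulLog_div_le hG (show G ≤ F + G by linarith)
    (show 0 < e / (1 + e) by positivity)
  rw [← key hF (by linarith), log_div one_ne_zero (by positivity), log_one] at h1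
  rw [← key hG (by linarith), log_div he.ne' (by positivity)] at h2
  have h3 : (F + G) * (1 / (1 + e)) + (F + G) * (e / (1 + e)) = F + G := by field_simp
  linarith

open Real in
lemma log_div_nonneg_of_le {x S : ℝ} (hx : 0 ≤ x) (hxS : x ≤ S) : 0 ≤ log (S / x) := by
  rcases hx.eq_or_lt with rfl | hx
  · simp
  · exact log_nonneg ((one_le_div hx).2 hxS)

lemma gFun_nonneg_s14 {x : ℝ} (hx : 0 ≤ x) : 0 ≤ gFun x := by
  unfold gFun
  rcases hx.eq_or_lt with rfl | hx
  · simp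
  have h1 := Real.log_le_log hx (show x ≤ x + 1 by linarith)
  have h2 := Real.log_nonneg (show 1 ≤ x + 1 by linarith)
  nlinarith [mul_le_mul_of_nonneg_left h1 hx.le]

lemma summable_column {f : ℕ × ℕ → ℝ} (hs : Summable f) (j : ℕ) :
    Summable fun i => f (i, j) :=
  hs.comp_injective (i := fun i => (i, j)) fun _ _ h => (Prod.ext_iff.1 h).1

lemma marg2_nonneg {f : ℕ × ℕ → ℝ} (hf : ∀ x, 0 ≤ f x) (j : ℕ) : 0 ≤ marg2 f j :=
  tsum_nonneg fun _ => hf _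

lemma le_marg2 {f : ℕ × ℕ → ℝ} (hf : ∀ x, 0 ≤ f x) (hs : Summable f) (i j : ℕ) :
    f (i, j) ≤ marg2 f j :=
  (summable_column hs j).le_tsum i fun _ _ => hf _

lemma marg2_add {f g : ℕ × ℕ → ℝ} (hf : Summable f) (hg : Summable g) (j : ℕ) :
    marg2 (fun x => f x + g x) j = marg2 f j + marg2 g j :=
  (summable_column hf j).tsum_add (summable_column hg j)

lemma ofReal_marg2 {f : ℕ × ℕ → ℝ} (hf : ∀ x, 0 ≤ f x) (hs : Summable f) (j : ℕ) :
    ENNReal.ofReal (marg2 f j) = ∑' i, ENNReal.ofReal (f (i, j)) :=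
  ENNReal.ofReal_tsum_of_nonneg (fun _ => hf _) (summable_column hs j)

lemma tsum_columns (F : ℕ × ℕ → ℝ≥0∞) : ∑' j, ∑' i, F (i, j) = ∑' x, F x := by
  rw [ENNReal.tsum_comm, ENNReal.tsum_prod']

lemma tsum_ofReal_marg2 {f : ℕ × ℕ → ℝ} (hf : ∀ x, 0 ≤ f x) (hs : Summable f) :
    ∑' j, ENNReal.ofReal (marg2 f j) = ENNReal.ofReal (∑' x, f x) := by
  simp_rw [ofReal_marg2 hf hs]
  rw [tsum_columns fun x => ENNReal.ofReal (f x), ENNReal.ofReal_tsum_of_nonneg hf hs]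

lemma condEnt_eq_tsum {f : ℕ × ℕ → ℝ} (hf : ∀ x, 0 ≤ f x) :
    condEnt f =
      ∑' j, ∑' i, ENNReal.ofReal (marg2 f j * Real.negMulLog (f (i, j) / marg2 f j)) := by
  simp_rw [condEnt, shEnt, ← ENNReal.tsum_mul_left, ENNReal.ofReal_mul (marg2_nonneg hf _)]

/-- The (unnormalised) conditional entropy is monotone. -/
lemma condEnt_mono {f g : ℕ × ℕ → ℝ} (hf : ∀ x, 0 ≤ f x) (hfg : ∀ x, f x ≤ g x)
    (hg : Summable g) : condEnt f ≤ condEnt g := by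
  have hs : Summable f := hg.of_nonneg_of_le hf hfg
  have hd : ∀ x, 0 ≤ g x - f x := fun x => sub_nonneg.2 (hfg x)
  have hds : Summable fun x => g x - f x := hg.sub hs
  rw [condEnt_eq_tsum hf, condEnt_eq_tsum fun x => (hf x).trans (hfg x)]
  refine ENNReal.tsum_le_tsum fun j => ENNReal.tsum_le_tsum fun i => ENNReal.ofReal_le_ofReal ?_
  have h1 := mul_negMulLog_div_add_le (hf (i, j)) (le_marg2 hf hs i j) (hd (i, j))
    (le_marg2 hd hds i j)
  have h2 := mul_negMulLog_div_nonneg (hd (i, j)) (le_marg2 hd hds i j)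
  have h3 := marg2_add hs hds j
  simp only [add_sub_cancel] at h1 h3
  rw [← h3] at h1
  exact (le_add_of_nonneg_right h2).trans h1

/-- The (unnormalised) conditional entropy is subadditive up to a mixing term. -/
lemma condEnt_add_le {f g : ℕ × ℕ → ℝ} (hf : ∀ x, 0 ≤ f x) (hg : ∀ x, 0 ≤ g x)
    (hfs : Summable f) (hgs : Summable g) {e : ℝ} (he0 : 0 < e) (he1 : e ≤ 1) :
    condEnt (fun x => f x + g x) ≤ condEnt f + condEnt g +
      ENNReal.ofReal ((∑' x, (f x + g x)) * Real.log (1 + e) + (∑' x, g x) * -Real.log e) := by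
  have hl1 : 0 ≤ Real.log (1 + e) := Real.log_nonneg (by linarith)
  have hl2 : 0 ≤ -Real.log e := neg_nonneg.2 (Real.log_nonpos he0.le he1)
  have hfg : ∀ x, 0 ≤ f x + g x := fun x => add_nonneg (hf x) (hg x)
  have hfgs : Summable fun x => f x + g x := hfs.add hgs
  rw [condEnt_eq_tsum hf, condEnt_eq_tsum hg, condEnt_eq_tsum hfg,
    ENNReal.ofReal_add (mul_nonneg (tsum_nonneg hfg) hl1) (mul_nonneg (tsum_nonneg hg) hl2),
    ENNReal.ofReal_mul (tsum_nonneg hfg), ENNReal.ofReal_mul (tsum_nonneg hg),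
    ← tsum_ofReal_marg2 hfg hfgs, ← tsum_ofReal_marg2 hg hgs, ← ENNReal.tsum_mul_right,
    ← ENNReal.tsum_mul_right, ← ENNReal.tsum_add, ← ENNReal.tsum_add, ← ENNReal.tsum_add]
  refine ENNReal.tsum_le_tsum fun j => ?_
  have hF := marg2_nonneg hf j
  have hG := marg2_nonneg hg j
  rw [marg2_add hfs hgs]
  set F := marg2 f j
  set G := marg2 g j
  have hL := log_div_nonneg_of_le hF (show F ≤ F + G by linarith)
  have hK := log_div_nonneg_of_le hG (show G ≤ F + G by linarith)
  calc _ ≤ ∑' i, (ENNReal.ofReal (F * Real.negMulLog (f (i, j) / F))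
          + ENNReal.ofReal (G * Real.negMulLog (g (i, j) / G))
          + (ENNReal.ofReal (f (i, j)) * ENNReal.ofReal (Real.log ((F + G) / F))
            + ENNReal.ofReal (g (i, j)) * ENNReal.ofReal (Real.log ((F + G) / G)))) := by
        refine ENNReal.tsum_le_tsum fun i => ?_
        have h1 := mul_negMulLog_div_nonneg (hf (i, j)) (le_marg2 hf hfs i j)
        have h2 := mul_negMulLog_div_nonneg (hg (i, j)) (le_marg2 hg hgs i j)
        have h3 := mul_nonneg (hf (i, j)) hL
        have h4 := mul_nonneg (hg (i, j)) hK
        rw [← ENNReal.ofReal_mul (hf _), ← ENNReal.ofReal_mul (hg _), ← ENNReal.ofReal_add h3 h4,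
          ← ENNReal.ofReal_add h1 h2, ← ENNReal.ofReal_add (by positivity) (by positivity)]
        exact ENNReal.ofReal_le_ofReal (mul_negMulLog_add_div_le (hf _) (le_marg2 hf hfs i j)
          (hg _) (le_marg2 hg hgs i j))
    _ = ∑' i, ENNReal.ofReal (F * Real.negMulLog (f (i, j) / F))
          + ∑' i, ENNReal.ofReal (G * Real.negMulLog (g (i, j) / G))
          + ENNReal.ofReal (F * Real.log ((F + G) / F) + G * Real.log ((F + G) / G)) := by
        rw [ENNReal.tsum_add, ENNReal.tsum_add, ENNReal.tsum_add, ENNReal.tsum_mul_right,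
          ENNReal.tsum_mul_right, ← ofReal_marg2 hf hfs, ← ofReal_marg2 hg hgs,
          ← ENNReal.ofReal_mul hF, ← ENNReal.ofReal_mul hG,
          ← ENNReal.ofReal_add (mul_nonneg hF hL) (mul_nonneg hG hK)]
    _ ≤ _ := by
        rw [← ENNReal.ofReal_mul (by positivity), ← ENNReal.ofReal_mul hG,
          ← ENNReal.ofReal_add (by positivity) (by positivity)]
        exact add_le_add le_rfl (ENNReal.ofReal_le_ofReal (mul_log_add_div_add_le hF hG he0))

/-- Among nonnegative functions of mass at most `s` and first moment at most `t`, the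
(unnormalised) conditional entropy is at most `s * g (t / s)`. -/
lemma condEnt_le_of_mean_le {f : ℕ × ℕ → ℝ} (hf : ∀ x, 0 ≤ f x) (hfs : Summable f) {s t : ℝ}
    (hs : 0 < s) (ht : 0 < t) (hfm : ∑' x, f x ≤ s)
    (hft : ∑' x : ℕ × ℕ, ENNReal.ofReal ((x.1 : ℝ) * f x) ≤ ENNReal.ofReal t) :
    condEnt f ≤ ENNReal.ofReal (s * gFun (t / s)) := by
  set θ : ℝ := t / (t + s) with hθ
  have hθ0 : 0 < θ := by positivity
  have hθ1 : θ < 1 := (div_lt_one (by positivity)).2 (by linarith)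
  set α : ℝ := -Real.log (1 - θ) with hα
  set β : ℝ := -Real.log θ with hβ
  have hα0 : 0 ≤ α := neg_nonneg.2 (Real.log_nonpos (by linarith) (by linarith))
  have hβ0 : 0 ≤ β := neg_nonneg.2 (Real.log_nonpos hθ0.le hθ1.le)
  have hval : s * gFun (t / s) = s * α + t * β := by
    have e1 : 1 - θ = s / (t + s) := by rw [hθ]; field_simp; ring
    have e2 : t / s + 1 = (t + s) / s := by field_simp
    rw [gFun, hα, hβ, e1, e2, hθ, Real.log_div hs.ne' (by positivity),
      Real.log_div ht.ne' (add_pos ht hs).ne', Real.log_div (by positivity) hs.ne',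
      Real.log_div ht.ne' hs.ne']
    field_simp
    ring
  have hgeo : ∑' i : ℕ, ENNReal.ofReal ((1 - θ) * θ ^ i) = 1 := by
    rw [← ENNReal.ofReal_tsum_of_nonneg (fun i => mul_nonneg (by linarith) (by positivity))
      ((summable_geometric_of_lt_one hθ0.le hθ1).mul_left _), tsum_mul_left,
      tsum_geometric_of_lt_one hθ0.le hθ1, mul_inv_cancel₀ (by linarith), ENNReal.ofReal_one]
  have key : condEnt f + ENNReal.ofReal (∑' x, f x) ≤
      ENNReal.ofReal (s * gFun (t / s)) + ENNReal.ofReal (∑' x, f x) := by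
    calc _ = ∑' j, ∑' i, (ENNReal.ofReal (marg2 f j * Real.negMulLog (f (i, j) / marg2 f j))
            + ENNReal.ofReal (f (i, j))) := by
          rw [condEnt_eq_tsum hf, ← tsum_ofReal_marg2 hf hfs, ← ENNReal.tsum_add]
          simp_rw [ENNReal.tsum_add, ofReal_marg2 hf hfs]
      _ ≤ ∑' j, ∑' i, (ENNReal.ofReal (f (i, j)) * ENNReal.ofReal α
            + ENNReal.ofReal ((i : ℝ) * f (i, j)) * ENNReal.ofReal β
            + ENNReal.ofReal (marg2 f j) * ENNReal.ofReal ((1 - θ) * θ ^ i)) := by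
          refine ENNReal.tsum_le_tsum fun j => ENNReal.tsum_le_tsum fun i => ?_
          have hx := hf (i, j)
          have hxF := le_marg2 hf hfs i j
          have hF := marg2_nonneg hf j
          have h1θ : 0 < 1 - θ := by linarith
          have hr : 0 < (1 - θ) * θ ^ i := by positivity
          have h := mul_negMulLog_div_le hx hxF hr
          rw [Real.log_mul h1θ.ne' (by positivity), Real.log_pow] at h
          rw [← ENNReal.ofReal_mul hx, ← ENNReal.ofReal_mul (by positivity),
            ← ENNReal.ofReal_mul hF, ← ENNReal.ofReal_add (mul_negMulLog_div_nonneg hx hxF) hx,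
            ← ENNReal.ofReal_add (by positivity) (by positivity),
            ← ENNReal.ofReal_add (by positivity) (by positivity)]
          apply ENNReal.ofReal_le_ofReal
          rw [hα, hβ]
          linarith
      _ = ENNReal.ofReal (∑' x, f x) * ENNReal.ofReal α
            + (∑' x : ℕ × ℕ, ENNReal.ofReal ((x.1 : ℝ) * f x)) * ENNReal.ofReal β
            + ENNReal.ofReal (∑' x, f x) := by
          simp_rw [ENNReal.tsum_add, ENNReal.tsum_mul_left, ENNReal.tsum_mul_right, hgeo, mul_one,
            tsum_ofReal_marg2 hf hfs, tsum_columns fun x => ENNReal.ofReal (f x),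
            tsum_columns fun x => ENNReal.ofReal ((x.1 : ℝ) * f x),
            ENNReal.ofReal_tsum_of_nonneg hf hfs]
      _ ≤ _ := by
          rw [hval, ENNReal.ofReal_add (by positivity) (by positivity), ENNReal.ofReal_mul hs.le,
            ENNReal.ofReal_mul ht.le]
          gcongr
  exact (ENNReal.add_le_add_iff_right ENNReal.ofReal_ne_top).1 key

/-- **One-sided continuity bound for the conditional Shannon entropy under a
mean (energy-type) constraint on the first distribution only**: if
`∑_{i,j} i·p(i,j) ≤ t` then `H(X₁|X₂)_p ≤ g(t)` and for any probability
distribution `q` on `ℕ×ℕ` with `TV(p,q) ≤ ε ≤ 1`,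
`H(X₁|X₂)_p − H(X₁|X₂)_q ≤ ε·g(t/ε) + g(ε)` in the extended reals. -/
theorem condEntropy_energy_one_side_bound
    (p : ℕ × ℕ → ℝ) (hp : IsProbDist p)
    (t : ℝ) (ht : 0 < t)
    (hpt : ∑' x : ℕ × ℕ, ENNReal.ofReal ((x.1 : ℝ) * p x) ≤ ENNReal.ofReal t)
    (q : ℕ × ℕ → ℝ) (hq : IsProbDist q)
    (ε : ℝ) (hε0 : 0 < ε) (hε1 : ε ≤ 1) (hTV : TVd p q ≤ ε) :
    condEnt p ≤ ENNReal.ofReal (gFun t) ∧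
    (condEnt p : EReal) - (condEnt q : EReal) ≤
      ((ε * gFun (t / ε) + gFun ε : ℝ) : EReal) := by
  have hps := hp.2.summable
  have hqs := hq.2.summable
  refine ⟨?_, ?_⟩
  · simpa using condEnt_le_of_mean_le hp.1 hps one_pos ht hp.2.tsum_eq.le hpt
  set a : ℕ × ℕ → ℝ := fun x => max (p x - q x) 0 with ha
  set m : ℕ × ℕ → ℝ := fun x => min (p x) (q x) with hm
  have ha0 : ∀ x, 0 ≤ a x := fun x => le_max_right _ _
  have hap : ∀ x, a x ≤ p x := fun x => max_le (by linarith [hq.1 x]) (hp.1 x)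
  have has : Summable a := hps.of_nonneg_of_le ha0 hap
  have hm0 : ∀ x, 0 ≤ m x := fun x => le_min (hp.1 x) (hq.1 x)
  have hmq : ∀ x, m x ≤ q x := fun x => min_le_right _ _
  have hms : Summable m := hqs.of_nonneg_of_le hm0 hmq
  have hma : (fun x => m x + a x) = p := by
    funext x
    rcases le_total (p x) (q x) with h | h
    · simp [ha, hm, h]
    · simp [ha, hm, h]
  have hamass : ∑' x, a x ≤ ε := by
    have h1 : ∀ x, a x = (1 / 2) * |p x - q x| + (1 / 2) * (p x - q x) := by
      intro x
      rw [ha]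
      rcases le_total (p x - q x) 0 with h | h
      · simp only [max_eq_right h, abs_of_nonpos h]
        ring
      · simp only [max_eq_left h, abs_of_nonneg h]
        ring
    have h2 : Summable fun x => p x - q x := hps.sub hqs
    rw [tsum_congr h1, (h2.abs.mul_left _).tsum_add (h2.mul_left _), tsum_mul_left, tsum_mul_left,
      hps.tsum_sub hqs, hp.2.tsum_eq, hq.2.tsum_eq, sub_self, mul_zero, add_zero]
    exact hTV
  have hat : ∑' x : ℕ × ℕ, ENNReal.ofReal ((x.1 : ℝ) * a x) ≤ ENNReal.ofReal t := by
    refine le_trans (ENNReal.tsum_le_tsum fun x => ENNReal.ofReal_le_ofReal ?_) hpt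
    exact mul_le_mul_of_nonneg_left (hap x) (Nat.cast_nonneg _)
  have hadd := condEnt_add_le hm0 ha0 hms has hε0 hε1
  have hpsum : ∑' x, (m x + a x) = 1 := by rw [hma, hp.2.tsum_eq]
  rw [hpsum, hma, one_mul] at hadd
  have hmix : Real.log (1 + ε) + (∑' x, a x) * -Real.log ε ≤ gFun ε := by
    have h1 := mul_le_mul_of_nonneg_right hamass (neg_nonneg.2 (Real.log_nonpos hε0.le hε1))
    have h2 := mul_nonneg hε0.le (Real.log_nonneg (show 1 ≤ ε + 1 by linarith))
    rw [gFun, add_comm 1 ε]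
    linarith
  have hg1 : 0 ≤ ε * gFun (t / ε) := mul_nonneg hε0.le (gFun_nonneg_s14 (by positivity))
  have hg2 := gFun_nonneg_s14 hε0.le
  have hfin : condEnt p ≤ ENNReal.ofReal (ε * gFun (t / ε) + gFun ε) + condEnt q := by
    calc condEnt p ≤ condEnt q + ENNReal.ofReal (ε * gFun (t / ε)) + ENNReal.ofReal (gFun ε) := by
          refine hadd.trans ?_
          gcongr
          · exact condEnt_mono hm0 hmq hqs
          · exact condEnt_le_of_mean_le ha0 has hε0 ht hamass hat
      _ = _ := by rw [ENNReal.ofReal_add hg1 hg2, add_assoc, add_comm]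
  have hcoe : (condEnt p : EReal) ≤
      ((ε * gFun (t / ε) + gFun ε : ℝ) : EReal) + (condEnt q : EReal) := by
    have h := EReal.coe_ennreal_le_coe_ennreal_iff.2 hfin
    rwa [EReal.coe_ennreal_add, EReal.coe_ennreal_ofReal, max_eq_left (add_nonneg hg1 hg2)] at h
  exact EReal.sub_le_of_le_add hcoe
end
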